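/- Let K be a finite field with q elements. The number of isomorphism classes of n-dimensional K-algebras equals (1/|GL_n(K)|) · Σ_{M ∈ GL_n(K)} q^{dim Eig_1(M^T ⊗ M^T ⊗ M^{-1})}. -/

import Mathlib

open Matrix Kronecker

variable {K : Type*} [Field K] {n : ℕ}

/-- The multiplication of the algebra `alg(M)` on `K^n`:
`e_i * e_j = ∑ k, (M i) j k • e_k`. -/
def algMul (M : Fin n → Matrix (Fin n) (Fin n) K) (x y : Fin n → K) : Fin n → K :=
  fun k => ∑ i, ∑ j, x i * y j * M i j k

/-- The right action `φ` of `GL n K` on tuples of matrices: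
`φ(M, G)_l = G⁻¹ (∑ i, G_{il} M_i) G`. -/
def phi (M : Fin n → Matrix (Fin n) (Fin n) K) (G : GL (Fin n) K) :
    Fin n → Matrix (Fin n) (Fin n) K :=
  fun l => (↑G⁻¹ : Matrix (Fin n) (Fin n) K) *
    (∑ i, (G : Matrix (Fin n) (Fin n) K) i l • M i) * (G : Matrix (Fin n) (Fin n) K)

/-- `algMul M` as a bilinear map. -/
def algMulL (M : Fin n → Matrix (Fin n) (Fin n) K) :
    (Fin n → K) →ₗ[K] (Fin n → K) →ₗ[K] (Fin n → K) :=
  LinearMap.mk₂ K (algMul M)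
    (fun x x' y => by ext k; simp [algMul, add_mul, Finset.sum_add_distrib])
    (fun c x y => by
      ext k; simp only [algMul, Pi.smul_apply, smul_eq_mul, Finset.mul_sum]
      exact Finset.sum_congr rfl fun i _ => Finset.sum_congr rfl fun j _ => by ring)
    (fun x y y' => by ext k; simp [algMul, mul_add, add_mul, Finset.sum_add_distrib])
    (fun c x y => by
      ext k; simp only [algMul, Pi.smul_apply, smul_eq_mul, Finset.mul_sum]
      exact Finset.sum_congr rfl fun i _ => Finset.sum_congr rfl fun j _ => by ring)

/-- Isomorphism of `n`-dimensional `K`-algebras, given as bilinear multiplications on `K^n`. -/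
def isoRelL (B B' : (Fin n → K) →ₗ[K] (Fin n → K) →ₗ[K] (Fin n → K)) : Prop :=
  ∃ f : (Fin n → K) ≃ₗ[K] (Fin n → K), ∀ x y, f (B x y) = B' (f x) (f y)

/-- Dimension of the eigenspace of `Mᵀ ⊗ Mᵀ ⊗ M⁻¹` for the eigenvalue 1. -/
noncomputable def eigdim (M : GL (Fin n) K) : ℕ :=
  Module.finrank K ↥(Module.End.eigenspace (Matrix.toLin'
    ((M : Matrix (Fin n) (Fin n) K)ᵀ ⊗ₖ
      ((M : Matrix (Fin n) (Fin n) K)ᵀ ⊗ₖ (↑M⁻¹ : Matrix (Fin n) (Fin n) K)))) 1)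


/-- Conjugation action on bilinear multiplications. -/
def conjB (g : GL (Fin n) K) (B : (Fin n → K) →ₗ[K] (Fin n → K) →ₗ[K] (Fin n → K)) :
    (Fin n → K) →ₗ[K] (Fin n → K) →ₗ[K] (Fin n → K) :=
  (B.compl₁₂ (Matrix.toLin' (↑g⁻¹ : Matrix (Fin n) (Fin n) K))
    (Matrix.toLin' (↑g⁻¹ : Matrix (Fin n) (Fin n) K))).compr₂
    (Matrix.toLin' (g : Matrix (Fin n) (Fin n) K))

theorem conjB_apply (g : GL (Fin n) K) (B : (Fin n → K) →ₗ[K] (Fin n → K) →ₗ[K] (Fin n → K))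
    (x y : Fin n → K) : conjB g B x y =
      (g : Matrix (Fin n) (Fin n) K) *ᵥ
        (B ((↑g⁻¹ : Matrix (Fin n) (Fin n) K) *ᵥ x) ((↑g⁻¹ : Matrix (Fin n) (Fin n) K) *ᵥ y)) := by
  simp [conjB]

theorem inv_mulVec_mulVec (g : GL (Fin n) K) (x : Fin n → K) :
    (↑g⁻¹ : Matrix (Fin n) (Fin n) K) *ᵥ ((g : Matrix (Fin n) (Fin n) K) *ᵥ x) = x := by
  rw [Matrix.mulVec_mulVec, Units.inv_mul, Matrix.one_mulVec]

theorem mulVec_inv_mulVec (g : GL (Fin n) K) (x : Fin n → K) :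
    (g : Matrix (Fin n) (Fin n) K) *ᵥ ((↑g⁻¹ : Matrix (Fin n) (Fin n) K) *ᵥ x) = x := by
  rw [Matrix.mulVec_mulVec, Units.mul_inv, Matrix.one_mulVec]

/-- The action as a `MulAction`. -/
@[reducible] def conjAction :
    MulAction (GL (Fin n) K) ((Fin n → K) →ₗ[K] (Fin n → K) →ₗ[K] (Fin n → K)) where
  smul := conjB
  one_smul B := by
    refine LinearMap.ext fun x => LinearMap.ext fun y => ?_
    change conjB 1 B x y = _
    rw [conjB_apply, inv_one, Units.val_one]
    simp only [Matrix.one_mulVec]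
  mul_smul g h B := by
    refine LinearMap.ext fun x => LinearMap.ext fun y => ?_
    change conjB (g * h) B x y = conjB g (conjB h B) x y
    rw [conjB_apply, conjB_apply, conjB_apply, _root_.mul_inv_rev, Units.val_mul, Units.val_mul]
    simp only [Matrix.mulVec_mulVec]

theorem conjB_eq_iff (g : GL (Fin n) K) (B B' : (Fin n → K) →ₗ[K] (Fin n → K) →ₗ[K] (Fin n → K)) :
    conjB g B = B' ↔ ∀ x y, (g : Matrix (Fin n) (Fin n) K) *ᵥ (B x y) =
      B' ((g : Matrix (Fin n) (Fin n) K) *ᵥ x) ((g : Matrix (Fin n) (Fin n) K) *ᵥ y) := by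
  constructor
  · rintro rfl x y
    rw [conjB_apply, inv_mulVec_mulVec, inv_mulVec_mulVec]
  · intro h
    refine LinearMap.ext fun x => LinearMap.ext fun y => ?_
    rw [conjB_apply, h, mulVec_inv_mulVec, mulVec_inv_mulVec]

theorem isoRelL_iff (B B' : (Fin n → K) →ₗ[K] (Fin n → K) →ₗ[K] (Fin n → K)) :
    isoRelL B B' ↔ ∃ g : GL (Fin n) K, conjB g B = B' := by
  constructor
  · rintro ⟨f, hf⟩
    refine ⟨Matrix.GeneralLinearGroup.toLin.symm
      (LinearMap.GeneralLinearGroup.ofLinearEquiv f), (conjB_eq_iff _ _ _).2 fun x y => ?_⟩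
    have key : ∀ x, ((Matrix.GeneralLinearGroup.toLin.symm
      (LinearMap.GeneralLinearGroup.ofLinearEquiv f) : GL (Fin n) K) :
        Matrix (Fin n) (Fin n) K) *ᵥ x = f x := by
      intro x
      change (LinearMap.toMatrix' (f : (Fin n → K) →ₗ[K] (Fin n → K))) *ᵥ x = f x
      rw [LinearMap.toMatrix'_mulVec]; rfl
    rw [key, key, key, hf]
  · rintro ⟨g, hg⟩
    rw [conjB_eq_iff] at hg
    exact ⟨LinearEquiv.ofLinearMap (Matrix.toLin' (g : Matrix (Fin n) (Fin n) K))
      (Matrix.toLin' (↑g⁻¹ : Matrix (Fin n) (Fin n) K))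
      (LinearMap.ext fun x => by
        rw [LinearMap.comp_apply, Matrix.toLin'_apply, Matrix.toLin'_apply]
        exact mulVec_inv_mulVec g x)
      (LinearMap.ext fun x => by
        rw [LinearMap.comp_apply, Matrix.toLin'_apply, Matrix.toLin'_apply]
        exact inv_mulVec_mulVec g x), fun x y => hg x y⟩

/-- Structure constants. -/
def structConst (B : (Fin n → K) →ₗ[K] (Fin n → K) →ₗ[K] (Fin n → K)) :
    Fin n × Fin n × Fin n → K :=
  fun p => B (Pi.single p.1 1) (Pi.single p.2.1 1) p.2.2

theorem bil_expand (B : (Fin n → K) →ₗ[K] (Fin n → K) →ₗ[K] (Fin n → K)) (x y : Fin n → K) :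
    B x y = fun k => ∑ i, ∑ j, x i * y j * structConst B (i, j, k) := by
  conv_lhs => rw [pi_eq_sum_univ' x, pi_eq_sum_univ' y]
  funext k
  simp [structConst, LinearMap.sum_apply, Finset.sum_apply, Finset.mul_sum, mul_assoc]
  rw [Finset.sum_comm]
  refine Finset.sum_congr rfl fun i _ => Finset.sum_congr rfl fun j _ => ?_
  ring

theorem bil_ext {B B' : (Fin n → K) →ₗ[K] (Fin n → K) →ₗ[K] (Fin n → K)}
    (h : structConst B = structConst B') : B = B' := by
  refine LinearMap.ext fun x => LinearMap.ext fun y => ?_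
  rw [bil_expand, bil_expand, h]

/-- Structure constants as an equivalence. -/
def structEquiv : ((Fin n → K) →ₗ[K] (Fin n → K) →ₗ[K] (Fin n → K)) ≃
    (Fin n × Fin n × Fin n → K) where
  toFun := structConst
  invFun v := algMulL fun i j k => v (i, j, k)
  left_inv B := by
    refine LinearMap.ext fun x => LinearMap.ext fun y => ?_
    rw [bil_expand B]
    rfl
  right_inv v := by
    funext ⟨i, j, k⟩
    simp [structConst, algMulL, algMul, Pi.single_apply]

theorem kron_structConst (g : GL (Fin n) K)
    (B : (Fin n → K) →ₗ[K] (Fin n → K) →ₗ[K] (Fin n → K)) :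
    ((g : Matrix (Fin n) (Fin n) K)ᵀ ⊗ₖ
      ((g : Matrix (Fin n) (Fin n) K)ᵀ ⊗ₖ (↑g⁻¹ : Matrix (Fin n) (Fin n) K))) *ᵥ structConst B
      = structConst (conjB g⁻¹ B) := by
  funext ⟨i, j, k⟩
  conv_rhs => rw [structConst, conjB_apply, inv_inv, bil_expand]
  simp only [Matrix.mulVec, dotProduct, Fintype.sum_prod_type, Matrix.kroneckerMap_apply,
    Matrix.transpose_apply, Finset.mul_sum, Pi.single_apply, mul_ite, mul_one, mul_zero,
    Finset.sum_ite_eq', Finset.sum_ite_eq, Finset.mem_univ, if_true]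
  rw [Finset.sum_comm_cycle]
  refine Finset.sum_congr rfl fun c _ => Finset.sum_congr rfl fun a _ =>
    Finset.sum_congr rfl fun b _ => ?_
  ring

theorem mem_eig_iff (g : GL (Fin n) K)
    (B : (Fin n → K) →ₗ[K] (Fin n → K) →ₗ[K] (Fin n → K)) :
    conjB g B = B ↔ structConst B ∈ Module.End.eigenspace (Matrix.toLin'
    ((g : Matrix (Fin n) (Fin n) K)ᵀ ⊗ₖ
      ((g : Matrix (Fin n) (Fin n) K)ᵀ ⊗ₖ (↑g⁻¹ : Matrix (Fin n) (Fin n) K)))) 1 := by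
  rw [Module.End.mem_eigenspace_iff, Matrix.toLin'_apply, kron_structConst, one_smul]
  have key : ∀ h : GL (Fin n) K, conjB h B = B → conjB h⁻¹ B = B := by
    intro h hB
    refine LinearMap.ext fun x => LinearMap.ext fun y => ?_
    conv_lhs => rw [← hB]
    rw [conjB_apply, conjB_apply, inv_inv, inv_mulVec_mulVec, inv_mulVec_mulVec,
      inv_mulVec_mulVec]
  have h : conjB g B = B ↔ conjB g⁻¹ B = B :=
    ⟨key g, fun h => by simpa only [inv_inv] using key g⁻¹ h⟩
  exact h.trans ⟨fun h => congrArg structConst h, bil_ext⟩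

/-- Burnside count: the number of isomorphism classes of `n`-dimensional algebras over a
finite field with `q` elements, times `|GL_n(K)|`, equals
`∑_{M ∈ GL_n(K)} q ^ dim Eig₁(Mᵀ ⊗ Mᵀ ⊗ M⁻¹)`. -/
theorem card_isoClasses {q : ℕ} [Fintype K] [DecidableEq K] (hq : Fintype.card K = q) :
    Nat.card (Quot (isoRelL (K := K) (n := n))) * Nat.card (GL (Fin n) K) =
      ∑ M : GL (Fin n) K, q ^ eigdim M := by
  letI := conjAction (K := K) (n := n)
  classical
  haveI : Finite ((Fin n → K) →ₗ[K] (Fin n → K) →ₗ[K] (Fin n → K)) :=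
    Finite.of_equiv _ structEquiv.symm
  letI : Fintype ((Fin n → K) →ₗ[K] (Fin n → K) →ₗ[K] (Fin n → K)) := Fintype.ofFinite _
  letI : Fintype (MulAction.orbitRel.Quotient (GL (Fin n) K)
    ((Fin n → K) →ₗ[K] (Fin n → K) →ₗ[K] (Fin n → K))) := Fintype.ofFinite _
  have burn := MulAction.sum_card_fixedBy_eq_card_orbits_mul_card_group (GL (Fin n) K)
    ((Fin n → K) →ₗ[K] (Fin n → K) →ₗ[K] (Fin n → K))
  have e : Quot (isoRelL (K := K) (n := n)) ≃ MulAction.orbitRel.Quotient (GL (Fin n) K)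
      ((Fin n → K) →ₗ[K] (Fin n → K) →ₗ[K] (Fin n → K)) := by
    refine Quot.congrRight fun B B' => ?_
    rw [isoRelL_iff]
    change _ ↔ (MulAction.orbitRel (GL (Fin n) K) _) B B'
    rw [← Setoid.comm' , MulAction.orbitRel_apply]
    rfl
  rw [Nat.card_congr e, Nat.card_eq_fintype_card, Nat.card_eq_fintype_card, ← burn]
  refine Finset.sum_congr rfl fun g _ => ?_
  rw [← Nat.card_eq_fintype_card, eigdim, ← hq, ← Nat.card_eq_fintype_card (α := K),
    ← Module.natCard_eq_pow_finrank]
  exact Nat.card_congr (structEquiv.subtypeEquiv fun B => mem_eig_iff g B)
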